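/- Let ω be a percolation configuration with 0 ∈ C and let r ≥ 2 be an integer. Then λ_1(B_r(C)) ≤ 8d · |B_r(C)| / (r^2 · |B_{r/2}(C)|), where λ_1(B_r(C)) is the smallest Dirichlet eigenvalue of the walk killed outside B_r(C), i.e. λ_1(B_r(C)) = inf{ ξ(f,f) / ||f||²_{l²(ν)} : f ≠ 0, supp(f) ⊂ B_r(C) } with ξ(f,f) = ((Id − P^{B_r(C)}) 1_{B_r(C)} f | f)_ν. -/

import Mathlib

open MeasureTheory
open scoped ENNReal

namespace Perco

/-- Vertices of the lattice `Z^d`. -/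
abbrev Zd (d : ℕ) := Fin d → ℤ

/-- A percolation configuration: each (unordered) edge of the lattice is open or closed.
(Only the values on nearest-neighbour pairs matter.) -/
abbrev Config (d : ℕ) := Sym2 (Zd d) → Bool

/-- Lattice adjacency: `(x,y) ∈ E^d`. -/
def latAdj {d : ℕ} (x y : Zd d) : Prop := (∑ i, |x i - y i|) = 1

/-- Open adjacency in the configuration `ω`. -/
def openAdj {d : ℕ} (ω : Config d) (x y : Zd d) : Prop :=
  latAdj x y ∧ ω s(x, y) = true

/-- `C`: the open cluster of the origin. -/
def cluster {d : ℕ} (ω : Config d) : Set (Zd d) :=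
  {y | Relation.ReflTransGen (openAdj ω) 0 y}

/-- `Q` is the product measure making the edge states i.i.d. Bernoulli(p). -/
def IsBernoulli {d : ℕ} (p : ℝ) (Q : Measure (Config d)) : Prop :=
  IsProbabilityMeasure Q ∧
    ∀ (s : Finset (Sym2 (Zd d))) (f : Sym2 (Zd d) → Bool),
      Q {ω : Config d | ∀ e ∈ s, ω e = f e} =
        ∏ e ∈ s, (if f e then ENNReal.ofReal p else ENNReal.ofReal (1 - p))

/-- The critical probability `p_c`. -/
noncomputable def pc (d : ℕ) : ℝ :=
  sSup {p : ℝ | 0 ≤ p ∧ p ≤ 1 ∧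
    ∀ Q : Measure (Config d), IsBernoulli p Q → Q {ω | (cluster ω).Infinite} = 0}

/-- The box `B_n = [-n,n]^d`. -/
def box (d n : ℕ) : Set (Zd d) := {x | ∀ i, |x i| ≤ (n : ℤ)}

/-- `C_n`: the connected component of `0` in `C ∩ B_n`. -/
def clusterN {d : ℕ} (ω : Config d) (n : ℕ) : Set (Zd d) :=
  {y | Relation.ReflTransGen
    (fun a b => openAdj ω a b ∧ a ∈ box d n ∧ b ∈ box d n) 0 y}

/-- `A` is connected in the open subgraph. -/
def ConnOpen {d : ℕ} (ω : Config d) (A : Set (Zd d)) : Prop :=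
  ∀ x ∈ A, ∀ y ∈ A,
    Relation.ReflTransGen (fun a b => openAdj ω a b ∧ a ∈ A ∧ b ∈ A) x y

/-- `A` is connected in the lattice. -/
def ConnLat {d : ℕ} (A : Set (Zd d)) : Prop :=
  ∀ x ∈ A, ∀ y ∈ A,
    Relation.ReflTransGen (fun a b => latAdj a b ∧ a ∈ A ∧ b ∈ A) x y

/-- The boundary `∂_{C^g} A` = open lattice edges from `A` to its complement. -/
def bdry {d : ℕ} (ω : Config d) (A : Set (Zd d)) : Set (Zd d × Zd d) :=
  {e | openAdj ω e.1 e.2 ∧ e.1 ∈ A ∧ e.2 ∉ A}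

/-- The profile `f_c` (at scale `n`, exponent `γ`). -/
noncomputable def fcut (d : ℕ) (γ c : ℝ) (n : ℕ) (x : ℝ) : ℝ :=
  if x < c * (n : ℝ) ^ γ then 1 else x ^ (1 - 1 / (d : ℝ))

/-- `ν(x)`: number of open neighbours of `x`. -/
noncomputable def nu {d : ℕ} (ω : Config d) (x : Zd d) : ℕ :=
  Set.ncard {y | openAdj ω x y}

-- Transition kernel of the simple random walk on the open subgraph.
open Classical in
noncomputable def step {d : ℕ} (ω : Config d) (x y : Zd d) : ℝ :=
  if openAdj ω x y then ((nu ω x : ℝ))⁻¹ else 0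

/-- Weight of a path of length `n`. -/
noncomputable def pathW {d n : ℕ} (ω : Config d) (γ : Fin (n + 1) → Zd d) : ℝ :=
  ∏ i : Fin n, step ω (γ i.castSucc) (γ i.succ)

/-- `N_n`: number of distinct sites visited by the path. -/
noncomputable def visits {d n : ℕ} (γ : Fin (n + 1) → Zd d) : ℕ :=
  (Set.range γ).ncard

/-- `P_0^ω(E)`, the probability of a path event for the walk started at 0. -/
noncomputable def PWalk {d : ℕ} (ω : Config d) (n : ℕ)
    (E : (Fin (n + 1) → Zd d) → Prop) : ℝ :=
  ∑' γ : Fin (n + 1) → Zd d,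
    Set.indicator {γ | γ 0 = 0 ∧ E γ} (fun γ => pathW ω γ) γ

/-- `E_0^ω(α^{N_n})`. -/
noncomputable def LaplaceN {d : ℕ} (ω : Config d) (α : ℝ) (n : ℕ) : ℝ :=
  ∑' γ : Fin (n + 1) → Zd d,
    Set.indicator {γ | γ 0 = 0} (fun γ => pathW ω γ * α ^ visits γ) γ

/-- `E_0^ω(α^{N_n} 1_{X_n = 0})`. -/
noncomputable def LaplaceNReturn {d : ℕ} (ω : Config d) (α : ℝ) (n : ℕ) : ℝ :=
  ∑' γ : Fin (n + 1) → Zd d,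
    Set.indicator {γ | γ 0 = 0 ∧ γ (Fin.last n) = 0}
      (fun γ => pathW ω γ * α ^ visits γ) γ

/-- Vertices of the wreath product `C^g ≀ Z/2Z` (lamplighter states). -/
abbrev Lamp (d : ℕ) := Zd d × (Zd d →₀ ZMod 2)

/-- Flip a lamp configuration at one point. -/
noncomputable def flipAt {σ : Type*} (f : σ →₀ ZMod 2) (x : σ) : σ →₀ ZMod 2 :=
  f + Finsupp.single x 1

/-- Transition kernel of the lamplighter walk `Z` with parameter `α`. -/
noncomputable def ptilde {d : ℕ} (ω : Config d) (α : ℝ) (u v : Lamp d) : ℝ :=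
  Set.indicator
    {q : Lamp d × Lamp d | ∀ x, x ≠ q.1.1 → x ≠ q.2.1 → q.1.2 x = q.2.2 x}
    (fun q => (if q.2.2 q.1.1 = 0 then α else 1 - α) *
      (if q.2.2 q.2.1 = 0 then α else 1 - α) * step ω q.1.1 q.2.1) (u, v)

/-- `P̃_o^ω(Z_n = o)`: return probability of the lamplighter walk. -/
noncomputable def ZReturn {d : ℕ} (ω : Config d) (α : ℝ) (n : ℕ) : ℝ :=
  ∑' γ : Fin (n + 1) → Lamp d,
    Set.indicator {γ | γ 0 = (0, 0) ∧ γ (Fin.last n) = (0, 0)}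
      (fun γ => ∏ i : Fin n, ptilde ω α (γ i.castSucc) (γ i.succ)) γ

/-- Vertex set of the wreath product over a vertex set `V` of the base. -/
def wVert {d : ℕ} (V : Set (Zd d)) : Set (Lamp d) :=
  {u | u.1 ∈ V ∧ ↑u.2.support ⊆ V}

/-- Adjacency in the wreath product `C^g ≀ Z/2Z`. -/
def wAdj {d : ℕ} (ω : Config d) (u v : Lamp d) : Prop :=
  (u.1 = v.1 ∧ (∀ x, x ≠ u.1 → u.2 x = v.2 x) ∧ u.2 u.1 ≠ v.2 u.1) ∨
    (u.2 = v.2 ∧ openAdj ω u.1 v.1)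

/-- Boundary of `U` in the wreath product `C^g ≀ Z/2Z`. -/
def wBdry {d : ℕ} (ω : Config d) (U : Set (Lamp d)) : Set (Lamp d × Lamp d) :=
  {e | e.1 ∈ U ∧ e.2 ∈ wVert (cluster ω) \ U ∧ wAdj ω e.1 e.2}

/-- Følner function `Fol_{C_n^g}^{C^g}` (with value `⊤` when no set qualifies). -/
noncomputable def FolC {d : ℕ} (ω : Config d) (n : ℕ) (k : ℝ) : ℝ≥0∞ :=
  sInf {m : ℝ≥0∞ | ∃ A : Set (Zd d), A ⊆ clusterN ω n ∧ A.Nonempty ∧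
    ((bdry ω A).ncard : ℝ) / (A.ncard : ℝ) ≤ 1 / k ∧ m = (A.ncard : ℝ≥0∞)}

/-- Følner function `Fol_{C_n^g ≀ Z/2Z}^{C^g ≀ Z/2Z}`. -/
noncomputable def FolW {d : ℕ} (ω : Config d) (n : ℕ) (k : ℝ) : ℝ≥0∞ :=
  sInf {m : ℝ≥0∞ | ∃ U : Set (Lamp d), U ⊆ wVert (clusterN ω n) ∧ U.Nonempty ∧
    ((wBdry ω U).ncard : ℝ) / (U.ncard : ℝ) ≤ 1 / k ∧ m = (U.ncard : ℝ≥0∞)}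

/-- Degree of a configuration `f` in the graph `K_U`. -/
noncomputable def Kdeg {d : ℕ} (U : Set (Lamp d)) (f : Zd d →₀ ZMod 2) : ℕ :=
  Set.ncard {g : Zd d →₀ ZMod 2 | ∃ x : Zd d, (x, f) ∈ U ∧ (x, g) ∈ U ∧ g = flipAt f x}

/-- A point `u = (x,f)` of `U` is bad if `(x, f̄_x) ∉ U`. -/
def badPt {d : ℕ} (U : Set (Lamp d)) (u : Lamp d) : Prop :=
  (u.1, flipAt u.2 u.1) ∉ U

/-- `D(0,x) ≤ r`: the chemical distance from the origin to `x` is at most `r`. -/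
def chemLE {d : ℕ} (ω : Config d) (x : Zd d) (r : ℕ) : Prop :=
  ∃ m ≤ r, ∃ γ : ℕ → Zd d, γ 0 = 0 ∧ γ m = x ∧ ∀ i < m, openAdj ω (γ i) (γ (i + 1))

/-- `B_r(C)`: chemical ball of radius `r` around the origin. -/
def chemBall {d : ℕ} (ω : Config d) (r : ℕ) : Set (Zd d) := {x | chemLE ω x r}

/-- Lattice connected component of `x` inside a vertex set `V`. -/
def latCompIn {d : ℕ} (V : Set (Zd d)) (x : Zd d) : Set (Zd d) :=
  {y | Relation.ReflTransGen (fun a b => latAdj a b ∧ a ∈ V ∧ b ∈ V) x y}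

/-- Open connected component of `x` inside a vertex set `V`. -/
def openCompIn {d : ℕ} (ω : Config d) (V : Set (Zd d)) (x : Zd d) : Set (Zd d) :=
  {y | Relation.ReflTransGen (fun a b => openAdj ω a b ∧ a ∈ V ∧ b ∈ V) x y}

/-- `L_n`: a connected component of the open subgraph inside `B_n` of maximal cardinality. -/
def IsLargestComp {d : ℕ} (ω : Config d) (n : ℕ) (L : Set (Zd d)) : Prop :=
  (∃ x ∈ box d n, L = openCompIn ω (box d n) x) ∧
    ∀ y ∈ box d n, (openCompIn ω (box d n) y).ncard ≤ L.ncard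

/-- `\bar L`: the connected component of `L` in the full open subgraph. -/
def closureOf {d : ℕ} (ω : Config d) (L : Set (Zd d)) : Set (Zd d) :=
  {y | ∃ x ∈ L, Relation.ReflTransGen (openAdj ω) x y}

/-- The boundary `∂_{\bar L_n^g} A`. -/
def bdryBar {d : ℕ} (ω : Config d) (n : ℕ) (L A : Set (Zd d)) : Set (Zd d × Zd d) :=
  {e | openAdj ω e.1 e.2 ∧ e.1 ∈ A ∩ closureOf ω L ∧ e.2 ∈ box d (n + 1) \ A}

/-- `n(A)`: number of connected components of `B_n − L` containing a component of `A`. -/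
noncomputable def nComp {d : ℕ} (n : ℕ) (L A : Set (Zd d)) : ℕ :=
  Set.ncard {P : Set (Zd d) |
    (∃ x ∈ box d n \ L, P = latCompIn (box d n \ L) x) ∧
    ∃ x ∈ A, latCompIn A x ⊆ P}

/-- The killed kernel `P^{B_r(C)}` acting on functions. -/
noncomputable def Pball {d : ℕ} (ω : Config d) (r : ℕ) (f : Zd d → ℝ) : Zd d → ℝ :=
  Set.indicator (chemBall ω r) (fun x =>
    ∑' y : Zd d, Set.indicator (chemBall ω r) (fun y => step ω x y * f y) y)

/-- The Dirichlet form `ξ(f,f) = ((Id − P^{B_r(C)}) 1_{B_r(C)} f | f)_ν`. -/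
noncomputable def dirichletForm {d : ℕ} (ω : Config d) (r : ℕ) (f : Zd d → ℝ) : ℝ :=
  ∑' x : Zd d, (nu ω x : ℝ) * f x *
    (Set.indicator (chemBall ω r) f x - Pball ω r (Set.indicator (chemBall ω r) f) x)

/-- `‖f‖²_{l²(ν)}`. -/
noncomputable def normSq {d : ℕ} (ω : Config d) (f : Zd d → ℝ) : ℝ :=
  ∑' x : Zd d, (nu ω x : ℝ) * f x ^ 2

/-- `λ_1(B_r(C))`: smallest Dirichlet eigenvalue of the killed walk. -/
noncomputable def lambda1 {d : ℕ} (ω : Config d) (r : ℕ) : ℝ :=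
  sInf {t : ℝ | ∃ f : Zd d → ℝ, f ≠ 0 ∧ Function.support f ⊆ chemBall ω r ∧
    t = dirichletForm ω r f / normSq ω f}

lemma openAdj.symm {d : ℕ} {ω : Config d} {x y : Zd d} (h : openAdj ω x y) : openAdj ω y x := by
  obtain ⟨h1, h2⟩ := h
  refine ⟨?_, by rwa [Sym2.eq_swap]⟩
  unfold latAdj at *
  simpa [abs_sub_comm] using h1

lemma setOf_latAdj_subset {d : ℕ} (x : Zd d) :
    {y | latAdj x y} ⊆ ((Finset.univ : Finset (Fin d × Bool)).image
      (fun p => Function.update x p.1 (x p.1 + if p.2 then 1 else -1)) : Set (Zd d)) := by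
  intro y (hy : ∑ i, |x i - y i| = 1)
  obtain ⟨i, -, hi⟩ : ∃ i ∈ Finset.univ, |x i - y i| ≠ 0 :=
    Finset.exists_ne_zero_of_sum_ne_zero (by rw [hy]; exact one_ne_zero)
  have hsplit := Finset.add_sum_erase Finset.univ (fun i => |x i - y i|) (Finset.mem_univ i)
  have hpos : 0 < |x i - y i| := lt_of_le_of_ne (abs_nonneg _) (Ne.symm hi)
  have hrest : 0 ≤ ∑ j ∈ Finset.univ.erase i, |x j - y j| :=
    Finset.sum_nonneg fun _ _ => abs_nonneg _
  have hzero : ∑ j ∈ Finset.univ.erase i, |x j - y j| = 0 := by omega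
  have hother : ∀ j, j ≠ i → y j = x j := fun j hj => by
    have := (Finset.sum_eq_zero_iff_of_nonneg fun _ _ => abs_nonneg _).1 hzero j (by simp [hj])
    rw [abs_eq_zero] at this
    omega
  have hone : |x i - y i| = 1 := by omega
  simp only [Finset.coe_image, Finset.coe_univ, Set.image_univ, Set.mem_range]
  refine ⟨(i, decide (x i < y i)), ?_⟩
  ext j
  by_cases hj : j = i
  · subst hj
    rcases (abs_eq zero_le_one).1 hone with h | h
    · have : ¬ x j < y j := by omega
      simp only [this, Function.update_self]
      simp; omega
    · have : x j < y j := by omega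
      simp only [this, Function.update_self]
      simp; omega
  · simp [hj, hother j hj]

lemma finite_setOf_latAdj {d : ℕ} (x : Zd d) : {y | latAdj x y}.Finite :=
  (Finset.finite_toSet _).subset (setOf_latAdj_subset x)

lemma ncard_setOf_latAdj_le {d : ℕ} (x : Zd d) : {y | latAdj x y}.ncard ≤ 2 * d := by
  refine (Set.ncard_le_ncard (setOf_latAdj_subset x) (Finset.finite_toSet _)).trans ?_
  rw [Set.ncard_coe_finset]
  refine Finset.card_image_le.trans ?_
  simp [mul_comm]

lemma finite_setOf_openAdj {d : ℕ} (ω : Config d) (x : Zd d) : {y | openAdj ω x y}.Finite :=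
  (finite_setOf_latAdj x).subset fun _ h => h.1

lemma nu_ne_zero {d : ℕ} {ω : Config d} {x y : Zd d} (h : openAdj ω x y) : nu ω x ≠ 0 :=
  Set.ncard_ne_zero_of_mem (a := y) h (finite_setOf_openAdj ω x)

lemma chemBall_mono {d : ℕ} (ω : Config d) {m n : ℕ} (h : m ≤ n) :
    chemBall ω m ⊆ chemBall ω n := fun _ ⟨k, hk, hγ⟩ => ⟨k, hk.trans h, hγ⟩

lemma zero_mem_chemBall {d : ℕ} (ω : Config d) (n : ℕ) : (0 : Zd d) ∈ chemBall ω n :=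
  ⟨0, n.zero_le, fun _ => 0, rfl, rfl, by simp⟩

lemma mem_chemBall_succ {d : ℕ} {ω : Config d} {n : ℕ} {x y : Zd d} (hx : x ∈ chemBall ω n)
    (h : openAdj ω x y) : y ∈ chemBall ω (n + 1) := by
  obtain ⟨m, hm, γ, h0, hγ, hstep⟩ := hx
  refine ⟨m + 1, by omega, fun i => if i ≤ m then γ i else y, by simp [h0], by simp, ?_⟩
  intro i hi
  rcases Nat.lt_succ_iff_lt_or_eq.1 hi with hi | rfl
  · have h1 : i ≤ m := hi.le
    have h2 : i + 1 ≤ m := hi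
    simpa [h1, h2] using hstep i hi
  · simpa [hγ] using h

lemma finite_chemBall {d : ℕ} (ω : Config d) (n : ℕ) : (chemBall ω n).Finite := by
  induction n with
  | zero =>
    refine (Set.finite_singleton (0 : Zd d)).subset ?_
    rintro x ⟨m, hm, γ, h0, hγ, -⟩
    obtain rfl : m = 0 := by omega
    exact hγ.symm.trans h0
  | succ n ih =>
    refine (ih.union (ih.biUnion fun x _ => finite_setOf_openAdj ω x)).subset ?_
    rintro x ⟨m, hm, γ, h0, hγ, hstep⟩
    rcases hm.lt_or_eq with hm | rfl
    · exact Or.inl ⟨m, by omega, γ, h0, hγ, hstep⟩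
    · refine Or.inr (Set.mem_biUnion (x := γ n) ?_ ?_)
      · exact ⟨n, le_rfl, γ, h0, rfl, fun i hi => hstep i (by omega)⟩
      · simpa [hγ] using hstep n (by omega)

lemma nu_ne_zero_of_mem_chemBall {d : ℕ} {ω : Config d} {n : ℕ} {x : Zd d}
    (hx : x ∈ chemBall ω n) (h0 : nu ω 0 ≠ 0) : nu ω x ≠ 0 := by
  obtain ⟨m, -, γ, hγ0, hγ, hstep⟩ := hx
  cases m with
  | zero => rwa [← hγ, hγ0]
  | succ m =>
    have := hstep m (by omega)
    rw [hγ] at this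
    exact nu_ne_zero this.symm

lemma eq_zero_of_mem_chemBall {d : ℕ} {ω : Config d} {n : ℕ} {x : Zd d}
    (hx : x ∈ chemBall ω n) (h0 : nu ω 0 = 0) : x = 0 := by
  obtain ⟨m, -, γ, hγ0, hγ, hstep⟩ := hx
  cases m with
  | zero => rw [← hγ, hγ0]
  | succ m =>
    have := hstep 0 (by omega)
    rw [hγ0] at this
    exact absurd h0 (nu_ne_zero this)

lemma nu_mul_step {d : ℕ} (ω : Config d) (x y : Zd d) [Decidable (openAdj ω x y)] :
    (nu ω x : ℝ) * step ω x y = if openAdj ω x y then 1 else 0 := by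
  unfold step
  split_ifs with h
  · exact mul_inv_cancel₀ (Nat.cast_ne_zero.2 (nu_ne_zero h))
  · exact mul_zero _

open Classical in
/-- The tent function `x ↦ (r - D(0,x))₊`, counted as the number of radii `k < r` with
`x ∈ B_k(C)`. -/
noncomputable def tent {d : ℕ} (ω : Config d) (r : ℕ) (x : Zd d) : ℝ :=
  ∑ k ∈ Finset.range r, if x ∈ chemBall ω k then 1 else 0

lemma tent_nonneg {d : ℕ} (ω : Config d) (r : ℕ) (x : Zd d) : 0 ≤ tent ω r x :=
  Finset.sum_nonneg fun _ _ => by split_ifs <;> norm_num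

lemma mem_chemBall_of_tent_ne_zero {d : ℕ} {ω : Config d} {r : ℕ} {x : Zd d}
    (h : tent ω r x ≠ 0) : x ∈ chemBall ω (r - 1) := by
  obtain ⟨k, hk, hne⟩ := Finset.exists_ne_zero_of_sum_ne_zero h
  rw [Finset.mem_range] at hk
  have hx : x ∈ chemBall ω k := by
    by_contra hx
    exact hne (if_neg hx)
  exact chemBall_mono ω (by omega) hx

lemma tent_le_tent_add_one {d : ℕ} {ω : Config d} (r : ℕ) {x y : Zd d} (h : openAdj ω x y) :
    tent ω r x ≤ tent ω r y + 1 := by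
  classical
  have hshift : tent ω r x ≤
      ∑ k ∈ Finset.range r, if y ∈ chemBall ω (k + 1) then (1 : ℝ) else 0 := by
    refine Finset.sum_le_sum fun k _ => ?_
    by_cases hx : x ∈ chemBall ω k
    · simp [hx, mem_chemBall_succ hx h]
    · rw [if_neg hx]; split_ifs <;> norm_num
  have h1 := Finset.sum_range_succ (fun k => if y ∈ chemBall ω k then (1 : ℝ) else 0) r
  have h2 := Finset.sum_range_succ' (fun k => if y ∈ chemBall ω k then (1 : ℝ) else 0) r
  have h3 : (if y ∈ chemBall ω r then (1 : ℝ) else 0) ≤ 1 := by split_ifs <;> norm_num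
  have h4 : (0 : ℝ) ≤ if y ∈ chemBall ω 0 then (1 : ℝ) else 0 := by split_ifs <;> norm_num
  unfold tent at *
  convert hshift.trans (by linarith :
    _ ≤ (∑ k ∈ Finset.range r, if y ∈ chemBall ω k then (1 : ℝ) else 0) + 1)

lemma half_le_tent {d : ℕ} {ω : Config d} {r : ℕ} {x : Zd d} (hx : x ∈ chemBall ω (r / 2)) :
    (r : ℝ) / 2 ≤ tent ω r x := by
  classical
  have hsum : ∑ k ∈ Finset.Ico (r / 2) r, (1 : ℝ) ≤ tent ω r x := by
    unfold tent
    calc ∑ k ∈ Finset.Ico (r / 2) r, (1 : ℝ)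
        = ∑ k ∈ Finset.Ico (r / 2) r, if x ∈ chemBall ω k then (1 : ℝ) else 0 := by
          refine Finset.sum_congr rfl fun k hk => ?_
          rw [if_pos (chemBall_mono ω (Finset.mem_Ico.1 hk).1 hx)]
      _ ≤ ∑ k ∈ Finset.range r, if x ∈ chemBall ω k then (1 : ℝ) else 0 := by
          refine Finset.sum_le_sum_of_subset_of_nonneg ?_ fun _ _ _ => by split_ifs <;> norm_num
          intro k hk
          exact Finset.mem_range.2 (Finset.mem_Ico.1 hk).2
      _ = _ := by congr!
  have hhalf : ((r / 2 : ℕ) : ℝ) ≤ r / 2 := by exact_mod_cast Nat.cast_div_le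
  rw [Finset.sum_const, Nat.card_Ico, nsmul_eq_mul, mul_one,
    Nat.cast_sub (Nat.div_le_self r 2)] at hsum
  linarith

open Classical in
/-- If `f` vanishes on points having an open neighbour outside the ball, its Dirichlet form is
half the sum of the squared increments along open edges inside the ball. -/
lemma dirichletForm_eq {d : ℕ} (ω : Config d) (r : ℕ) (f : Zd d → ℝ)
    (hf : Function.support f ⊆ chemBall ω r)
    (hint : ∀ x, f x ≠ 0 → ∀ y, openAdj ω x y → y ∈ chemBall ω r) :
    dirichletForm ω r f = ∑ x ∈ (finite_chemBall ω r).toFinset,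
      ∑ y ∈ (finite_chemBall ω r).toFinset,
        (if openAdj ω x y then (1 : ℝ) else 0) * (f x - f y) ^ 2 / 2 := by
  set B := (finite_chemBall ω r).toFinset with hB
  have hmem : ∀ x, x ∈ B ↔ x ∈ chemBall ω r := fun x => Set.Finite.mem_toFinset _
  have hind : Set.indicator (chemBall ω r) f = f := Set.indicator_eq_self.2 hf
  have hP : ∀ x ∈ B, Pball ω r f x = ∑ y ∈ B, step ω x y * f y := by
    intro x hx
    rw [Pball, Set.indicator_of_mem ((hmem x).1 hx), tsum_eq_sum (s := B)]
    · exact Finset.sum_congr rfl fun y hy => Set.indicator_of_mem ((hmem y).1 hy) _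
    · exact fun y hy => Set.indicator_of_notMem (fun h => hy ((hmem y).2 h)) _
  have hnu : ∀ x, f x ≠ 0 → (nu ω x : ℝ) = ∑ y ∈ B, if openAdj ω x y then (1 : ℝ) else 0 := by
    intro x hx
    have : {y | openAdj ω x y} = (B.filter (openAdj ω x) : Finset (Zd d)) := by
      ext y
      simp only [Set.mem_ofPred_eq, Finset.coe_filter, hmem]
      exact ⟨fun h => ⟨hint x hx y h, h⟩, fun h => h.2⟩
    rw [nu, this, Set.ncard_coe_finset, Finset.sum_boole]
  have hterm : dirichletForm ω r f = ∑ x ∈ B, ∑ y ∈ B,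
      (if openAdj ω x y then (1 : ℝ) else 0) * (f x ^ 2 - f x * f y) := by
    rw [dirichletForm, hind, tsum_eq_sum (s := B)]
    · refine Finset.sum_congr rfl fun x hx => ?_
      by_cases h0 : f x = 0
      · simp [h0]
      · have hcross : (nu ω x : ℝ) * ∑ y ∈ B, step ω x y * f y =
            ∑ y ∈ B, (if openAdj ω x y then (1 : ℝ) else 0) * f y := by
          rw [Finset.mul_sum]
          exact Finset.sum_congr rfl fun y _ => by rw [← mul_assoc, nu_mul_step]
        rw [hP x hx]
        calc (nu ω x : ℝ) * f x * (f x - ∑ y ∈ B, step ω x y * f y)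
            = nu ω x * f x ^ 2 - f x * (nu ω x * ∑ y ∈ B, step ω x y * f y) := by ring
          _ = _ := by
            rw [hcross, hnu x h0, Finset.sum_mul, Finset.mul_sum, ← Finset.sum_sub_distrib]
            exact Finset.sum_congr rfl fun y _ => by ring
    · intro x hx
      have : f x = 0 := by
        by_contra h
        exact hx ((hmem x).2 (hf h))
      simp [this]
  have hswap : ∑ x ∈ B, ∑ y ∈ B, (if openAdj ω x y then (1 : ℝ) else 0) * f x ^ 2 =
      ∑ x ∈ B, ∑ y ∈ B, (if openAdj ω x y then (1 : ℝ) else 0) * f y ^ 2 := by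
    rw [Finset.sum_comm]
    refine Finset.sum_congr rfl fun x _ => Finset.sum_congr rfl fun y _ => ?_
    rw [if_congr (⟨openAdj.symm, openAdj.symm⟩ : openAdj ω y x ↔ openAdj ω x y) rfl rfl]
  have hsplit : ∑ x ∈ B, ∑ y ∈ B,
        (if openAdj ω x y then (1 : ℝ) else 0) * (f x ^ 2 - f x * f y) =
      ∑ x ∈ B, ∑ y ∈ B, (if openAdj ω x y then (1 : ℝ) else 0) * (f x - f y) ^ 2 / 2 +
      (∑ x ∈ B, ∑ y ∈ B, (if openAdj ω x y then (1 : ℝ) else 0) * f x ^ 2 -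
        ∑ x ∈ B, ∑ y ∈ B, (if openAdj ω x y then (1 : ℝ) else 0) * f y ^ 2) / 2 := by
    simp only [← Finset.sum_sub_distrib, Finset.sum_div, ← Finset.sum_add_distrib]
    exact Finset.sum_congr rfl fun x _ => Finset.sum_congr rfl fun y _ => by ring
  rw [hterm, hsplit, hswap, sub_self, zero_div, add_zero]

lemma dirichletForm_tent_le {d : ℕ} (ω : Config d) {r : ℕ} (hr : 1 ≤ r) :
    dirichletForm ω r (tent ω r) ≤ d * (chemBall ω r).ncard := by
  classical
  rw [dirichletForm_eq ω r (tent ω r)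
    (fun x hx => chemBall_mono ω (Nat.sub_le r 1) (mem_chemBall_of_tent_ne_zero hx))
    (fun x hx y hxy => by
      simpa [Nat.sub_add_cancel hr] using
        mem_chemBall_succ (mem_chemBall_of_tent_ne_zero hx) hxy)]
  set B := (finite_chemBall ω r).toFinset
  have hcard : (chemBall ω r).ncard = B.card := Set.ncard_eq_toFinset_card _ _
  rw [hcard, mul_comm (d : ℝ), ← nsmul_eq_mul]
  refine Finset.sum_le_card_nsmul _ _ _ fun x _ => ?_
  calc ∑ y ∈ B, (if openAdj ω x y then (1 : ℝ) else 0) * (tent ω r x - tent ω r y) ^ 2 / 2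
      ≤ ∑ y ∈ B, (if openAdj ω x y then (1 : ℝ) else 0) / 2 := by
        refine Finset.sum_le_sum fun y _ => ?_
        split_ifs with h
        · have h1 := tent_le_tent_add_one r h
          have h2 := tent_le_tent_add_one r h.symm
          have : (tent ω r x - tent ω r y) ^ 2 ≤ 1 :=
            (sq_le_one_iff_abs_le_one _).2 (abs_le.2 ⟨by linarith, by linarith⟩)
          linarith
        · simp
    _ = ((B.filter (openAdj ω x)).card : ℝ) / 2 := by
        rw [← Finset.sum_div, Finset.sum_boole]
    _ ≤ d := by
        have hsub : ((B.filter (openAdj ω x) : Finset (Zd d)) : Set (Zd d)) ⊆ {y | latAdj x y} :=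
          fun y hy => (Finset.mem_filter.1 hy).2.1
        have hle := (Set.ncard_le_ncard hsub (finite_setOf_latAdj x)).trans
          (ncard_setOf_latAdj_le x)
        rw [Set.ncard_coe_finset] at hle
        have : ((B.filter (openAdj ω x)).card : ℝ) ≤ 2 * d := by exact_mod_cast hle
        linarith

lemma normSq_eq_sum {d : ℕ} (ω : Config d) (r : ℕ) (f : Zd d → ℝ)
    (hf : Function.support f ⊆ chemBall ω r) :
    normSq ω f = ∑ x ∈ (finite_chemBall ω r).toFinset, (nu ω x : ℝ) * f x ^ 2 := by
  refine tsum_eq_sum fun x hx => ?_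
  have : f x = 0 := by
    by_contra h
    exact hx ((Set.Finite.mem_toFinset _).2 (hf h))
  simp [this]

lemma le_normSq_tent {d : ℕ} {ω : Config d} (r : ℕ) (h0 : nu ω 0 ≠ 0) :
    (r : ℝ) ^ 2 / 4 * (chemBall ω (r / 2)).ncard ≤ normSq ω (tent ω r) := by
  rw [normSq_eq_sum ω r (tent ω r)
    (fun x hx => chemBall_mono ω (Nat.sub_le r 1) (mem_chemBall_of_tent_ne_zero hx)),
    Set.ncard_eq_toFinset_card _ (finite_chemBall ω (r / 2)), mul_comm, ← nsmul_eq_mul]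
  refine (Finset.card_nsmul_le_sum _ (fun x => (nu ω x : ℝ) * tent ω r x ^ 2) _ ?_).trans
    (Finset.sum_le_sum_of_subset_of_nonneg ?_ fun _ _ _ => by positivity)
  · intro x hx
    rw [Set.Finite.mem_toFinset] at hx
    have h1 : (1 : ℝ) ≤ nu ω x := by
      exact_mod_cast Nat.one_le_iff_ne_zero.2 (nu_ne_zero_of_mem_chemBall hx h0)
    have h2 := pow_le_pow_left₀ (by positivity) (half_le_tent hx) 2
    have h3 : (0 : ℝ) ≤ tent ω r x ^ 2 := sq_nonneg _
    nlinarith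
  · exact Set.Finite.toFinset_subset_toFinset.2 (chemBall_mono ω (Nat.div_le_self r 2))

/-- upper bound on the smallest Dirichlet eigenvalue of the killed walk. -/
theorem stmt19 (d : ℕ) (hd : 2 ≤ d) (ω : Config d) (r : ℕ) (hr : 2 ≤ r) :
    lambda1 ω r ≤
      8 * (d : ℝ) * ((chemBall ω r).ncard : ℝ) /
        ((r : ℝ) ^ 2 * ((chemBall ω (r / 2)).ncard : ℝ)) := by
  have hrhs : 0 ≤ 8 * (d : ℝ) * ((chemBall ω r).ncard : ℝ) /
      ((r : ℝ) ^ 2 * ((chemBall ω (r / 2)).ncard : ℝ)) := by positivity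
  by_cases hbdd : BddBelow {t : ℝ | ∃ f : Zd d → ℝ, f ≠ 0 ∧
      Function.support f ⊆ chemBall ω r ∧ t = dirichletForm ω r f / normSq ω f}
  swap
  · rw [lambda1, Real.sInf_of_not_bddBelow hbdd]
    exact hrhs
  have hr0 : (0 : ℝ) < r := by exact_mod_cast (by omega : 0 < r)
  have hsupp : Function.support (tent ω r) ⊆ chemBall ω r := fun x hx =>
    chemBall_mono ω (Nat.sub_le r 1) (mem_chemBall_of_tent_ne_zero hx)
  have hne : tent ω r ≠ 0 := fun h => by
    have h0 := half_le_tent (r := r) (zero_mem_chemBall ω (r / 2))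
    rw [h, Pi.zero_apply] at h0
    linarith
  refine (csInf_le hbdd ⟨tent ω r, hne, hsupp, rfl⟩).trans ?_
  by_cases h0 : nu ω 0 = 0
  · have hnorm : normSq ω (tent ω r) = 0 := by
      rw [normSq_eq_sum ω r _ hsupp]
      refine Finset.sum_eq_zero fun x hx => ?_
      rw [eq_zero_of_mem_chemBall ((Set.Finite.mem_toFinset _).1 hx) h0, h0]
      simp
    rw [hnorm, div_zero]
    exact hrhs
  · have hcard : (0 : ℝ) < (chemBall ω (r / 2)).ncard := by
      exact_mod_cast (Set.ncard_pos (finite_chemBall ω (r / 2))).2 ⟨0, zero_mem_chemBall ω _⟩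
    calc dirichletForm ω r (tent ω r) / normSq ω (tent ω r)
        ≤ d * (chemBall ω r).ncard / ((r : ℝ) ^ 2 / 4 * (chemBall ω (r / 2)).ncard) :=
          div_le_div₀ (by positivity) (dirichletForm_tent_le ω (by omega)) (by positivity)
            (le_normSq_tent r h0)
      _ = 4 * d * (chemBall ω r).ncard / ((r : ℝ) ^ 2 * (chemBall ω (r / 2)).ncard) := by
          field_simp
      _ ≤ _ := by gcongr; norm_num

end Perco
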